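/- Let G(q) = ∏_{n≥1} 1/((1 − q^{5n-1})(1 − q^{5n-4})) and H(q) = ∏_{n≥1} 1/((1 − q^{5n-2})(1 − q^{5n-3})), and φ(q) = ∏_{n≥1}(1 − q^n). Then, as formal power series in q: G(q)·G(q⁴) + q·H(q)·H(q⁴) = φ(q²)⁴ / ( φ(q⁴)² · φ(q)² ). -/

import Mathlib

open PowerSeries

noncomputable instance : TopologicalSpace (PowerSeries ℚ) :=
  inferInstanceAs (TopologicalSpace ((Unit →₀ ℕ) → ℚ))

/-- `G(q^j) = ∏_{n ≥ 1} 1/((1 - q^{j(5n-1)})(1 - q^{j(5n-4)}))`, the first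
Rogers–Ramanujan product evaluated at `q^j`. -/
noncomputable def G (j : ℕ) : PowerSeries ℚ :=
  ∏' n : ℕ, ((1 - (X : ℚ⟦X⟧) ^ (j * (5 * n + 4))) * (1 - X ^ (j * (5 * n + 1))))⁻¹

/-- `H(q^j) = ∏_{n ≥ 1} 1/((1 - q^{j(5n-2)})(1 - q^{j(5n-3)}))`, the second
Rogers–Ramanujan product evaluated at `q^j`. -/
noncomputable def H (j : ℕ) : PowerSeries ℚ :=
  ∏' n : ℕ, ((1 - (X : ℚ⟦X⟧) ^ (j * (5 * n + 3))) * (1 - X ^ (j * (5 * n + 2))))⁻¹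

/-- `φ(q^j) = ∏_{n ≥ 1} (1 - q^{j n})`. -/
noncomputable def phi (j : ℕ) : PowerSeries ℚ :=
  ∏' n : ℕ, (1 - (X : ℚ⟦X⟧) ^ (j * (n + 1)))

/-- The substitution `q ↦ -q`, a ring endomorphism of `ℚ⟦q⟧`. -/
noncomputable def neg : PowerSeries ℚ →+* PowerSeries ℚ := rescale (-1)

open Filter Finset Topology

noncomputable section

instance : IsTopologicalRing ℚ⟦X⟧ := PowerSeries.WithPiTopology.instIsTopologicalRing ℚ

instance : T2Space ℚ⟦X⟧ := PowerSeries.WithPiTopology.instT2Space ℚ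

/-- The `q`-Pochhammer product `∏_{i < n} (1 - q ^ (i + 1))`. -/
def qPochhammer {R : Type*} [CommRing R] (q : R) (n : ℕ) : R :=
  ∏ i ∈ range n, (1 - q ^ (i + 1))

/-- The Gaussian binomial coefficient, defined by the `q`-Pascal recursion. -/
def qBinomial {R : Type*} [CommRing R] (q : R) : ℕ → ℕ → R
  | _, 0 => 1
  | 0, _ + 1 => 0
  | n + 1, k + 1 => qBinomial q n k + q ^ (k + 1) * qBinomial q n (k + 1)

section qBinomial

variable {R : Type*} [CommRing R] (q : R)

theorem qBinomial_zero_right (n : ℕ) : qBinomial q n 0 = 1 := by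
  cases n <;> simp [qBinomial]

theorem qBinomial_eq_zero_of_lt {n k : ℕ} (h : n < k) : qBinomial q n k = 0 := by
  induction n generalizing k with
  | zero => cases k with
    | zero => omega
    | succ k => simp [qBinomial]
  | succ n ih => cases k with
    | zero => omega
    | succ k => simp [qBinomial, ih (show n < k by omega), ih (show n < k + 1 by omega)]

theorem qBinomial_self (n : ℕ) : qBinomial q n n = 1 := by
  induction n with
  | zero => simp [qBinomial]
  | succ n ih => simp [qBinomial, ih, qBinomial_eq_zero_of_lt q (Nat.lt_succ_self n)]

theorem qBinomial_mul_qPochhammer (i m : ℕ) :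
    qBinomial q (i + m) i * (qPochhammer q i * qPochhammer q m) = qPochhammer q (i + m) := by
  induction h : i + m generalizing i m with
  | zero =>
    obtain ⟨rfl, rfl⟩ : i = 0 ∧ m = 0 := by omega
    simp [qBinomial, qPochhammer]
  | succ N ih =>
    rcases i with _ | i
    · obtain rfl : m = N + 1 := by omega
      simp [qBinomial_zero_right, qPochhammer]
    rcases m with _ | m
    · obtain rfl : i = N := by omega
      simp [qBinomial_self, qPochhammer]
    have h1 := ih i (m + 1) (by omega)
    have h2 := ih (i + 1) m (by omega)
    have hs (t : ℕ) : qPochhammer q (t + 1) = qPochhammer q t * (1 - q ^ (t + 1)) :=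
      prod_range_succ _ _
    have hN : q ^ (N + 1) = q ^ (i + 1) * q ^ (m + 1) := by rw [← pow_add]; congr 1; omega
    simp only [qBinomial, hs] at h1 h2 ⊢
    rw [hN]
    linear_combination (1 - q ^ (i + 1)) * h1 + q ^ (i + 1) * (1 - q ^ (m + 1)) * h2

/-- The homogeneous `q`-binomial theorem. -/
theorem prod_add_mul_pow_eq_sum_qBinomial (y z : R) (N : ℕ) :
    ∏ i ∈ range N, (y + z * q ^ i) =
      ∑ i ∈ range (N + 1), q ^ i.choose 2 * qBinomial q N i * z ^ i * y ^ (N - i) := by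
  induction N generalizing z with
  | zero => simp [qBinomial]
  | succ N ih =>
    have hrec : ∏ i ∈ range (N + 1), (y + z * q ^ i) =
        (y + z) * ∏ i ∈ range N, (y + (z * q) * q ^ i) := by
      rw [prod_range_succ', mul_comm]
      simp [pow_succ', mul_assoc]
    rw [hrec, ih, add_mul, sum_range_succ' _ (N + 1), mul_sum, mul_sum]
    have hy : ∑ i ∈ range (N + 1), y * (q ^ i.choose 2 * qBinomial q N i * (z * q) ^ i *
        y ^ (N - i)) = ∑ i ∈ range (N + 1), q ^ (i + 1).choose 2 *
          (q ^ (i + 1) * qBinomial q N (i + 1)) * z ^ (i + 1) * y ^ (N - i) + y ^ (N + 1) := by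
      rw [sum_range_succ', sum_range_succ _ N, qBinomial_eq_zero_of_lt q (Nat.lt_succ_self N)]
      simp only [qBinomial_zero_right, mul_zero, zero_mul, add_zero]
      congr 1
      · refine sum_congr rfl fun i hi => ?_
        obtain ⟨t, rfl⟩ := Nat.exists_eq_add_of_lt (mem_range.mp hi)
        rw [show i + t + 1 - (i + 1) = t by omega, show i + t + 1 - i = t + 1 by omega]
        ring
      · simp [pow_succ']
    rw [hy, add_right_comm, ← sum_add_distrib]
    congr 1
    · refine sum_congr rfl fun i _ => ?_
      rw [show N + 1 - (i + 1) = N - i by omega, Nat.choose_succ_succ' i 1, Nat.choose_one_right]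
      simp only [qBinomial]
      ring
    · simp [qBinomial]

theorem dvd_qPochhammer_sub (m u : ℕ) (h : m ≤ u) :
    q ^ (m + 1) ∣ qPochhammer q u - qPochhammer q m := by
  induction u, h using Nat.le_induction with
  | base => simp
  | succ u hu ih =>
    have : qPochhammer q (u + 1) - qPochhammer q m =
        (qPochhammer q u - qPochhammer q m) - q ^ (u + 1) * qPochhammer q u := by
      rw [qPochhammer, prod_range_succ, ← qPochhammer]; ring
    rw [this]
    exact dvd_sub ih ((pow_dvd_pow q (by omega)).mul_right _)

theorem dvd_qPochhammer_mul_qBinomial_sub_one {n i m : ℕ} (hi : i ≤ 2 * n) (hmi : m ≤ i)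
    (hm : m ≤ 2 * n - i) (hmn : m ≤ n) (hu : IsUnit (qPochhammer q m)) :
    q ^ (m + 1) ∣ qPochhammer q n * qBinomial q (2 * n) i - 1 := by
  have h := qBinomial_mul_qPochhammer q i (2 * n - i)
  rw [Nat.add_sub_cancel' hi] at h
  obtain ⟨a, ha⟩ := dvd_qPochhammer_sub q m i hmi
  obtain ⟨b, hb⟩ := dvd_qPochhammer_sub q m _ hm
  obtain ⟨c, hc⟩ := dvd_qPochhammer_sub q m n hmn
  obtain ⟨d, hd⟩ := dvd_qPochhammer_sub q m (2 * n) (by omega)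
  rw [sub_eq_iff_eq_add] at ha hb hc hd
  rw [← (hu.mul hu).dvd_mul_left]
  rw [ha, hb, hd] at h
  refine ⟨qPochhammer q m * d + c * (q ^ (m + 1) * d + qPochhammer q m) - qPochhammer q n *
    qBinomial q (2 * n) i * (a * (q ^ (m + 1) * b + qPochhammer q m) + b * qPochhammer q m), ?_⟩
  have h' := congrArg (qPochhammer q n * ·) h
  linear_combination h' + (q ^ (m + 1) * d + qPochhammer q m) * hc

end qBinomial

/-- The exponent `k * j * (j - 1) / 2 + a * j` of the `j`-th term of a theta series. -/
def thetaExp (k a : ℕ) (j : ℤ) : ℕ := (k * (j * (j - 1) / 2) + a * j).toNat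

theorem two_mul_thetaExp {k a : ℕ} (h : a ≤ k) (j : ℤ) :
    2 * (thetaExp k a j : ℤ) = k * (j * (j - 1)) + 2 * a * j := by
  obtain ⟨t, ht⟩ : ∃ t, j * (j - 1) = 2 * t := (Int.even_mul_pred_self j).two_dvd
  have hk : (a : ℤ) ≤ k := by exact_mod_cast h
  have hnn : 0 ≤ (k : ℤ) * t + a * j := by
    rcases le_or_gt 0 j with hj | hj
    · have : 0 ≤ t := by
        rcases hj.eq_or_lt with rfl | hj'
        · linarith
        · nlinarith
      positivity
    · have : -j ≤ t := by nlinarith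
      nlinarith
  rw [thetaExp, ht, Int.mul_ediv_cancel_left _ two_ne_zero, Int.toNat_of_nonneg hnn]
  ring

theorem le_two_mul_thetaExp {k a : ℕ} (h : a ≤ k) (j : ℤ) :
    (k : ℤ) * (|j| * (|j| - 1)) ≤ 2 * thetaExp k a j := by
  rw [two_mul_thetaExp h]
  have hk : (a : ℤ) ≤ k := by exact_mod_cast h
  rcases le_or_gt 0 j with hj | hj
  · rw [abs_of_nonneg hj]
    nlinarith [mul_nonneg (Int.natCast_nonneg a) hj]
  · rw [abs_of_neg hj]
    nlinarith

theorem abs_le_thetaExp_add_one {k a : ℕ} (hk : 0 < k) (h : a ≤ k) (j : ℤ) :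
    |j| ≤ thetaExp k a j + 1 := by
  have h1 := le_two_mul_thetaExp h j
  have hk' : (1 : ℤ) ≤ k := by exact_mod_cast hk
  have h0 := abs_nonneg j
  rcases eq_or_lt_of_le h0 with h2 | h2
  · omega
  · have : 0 ≤ |j| * (|j| - 1) := mul_nonneg h0 (by omega)
    nlinarith

theorem le_thetaExp_add {k a n : ℕ} (hk : 0 < k) (h : a ≤ k) (j : ℤ) (hj : |j| ≤ n) :
    n ≤ thetaExp k a j + k * (n - j.natAbs + 1) := by
  have h1 := le_two_mul_thetaExp h j
  have hk' : (1 : ℤ) ≤ k := by exact_mod_cast hk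
  rw [Int.abs_eq_natAbs] at h1 hj
  zify [show j.natAbs ≤ n by omega]
  have hn : (n : ℤ) ≤ k * n := by nlinarith
  rw [← Int.abs_eq_natAbs] at h1 hj
  generalize |j| = t at *
  have : 0 ≤ (t - 1) * (t - 2) := by
    rcases le_or_gt t 1 with h | h
    · exact mul_nonneg_of_nonpos_of_nonpos (by omega) (by omega)
    · exact mul_nonneg (by omega) (by omega)
  nlinarith

theorem finite_thetaExp_le {k a : ℕ} (hk : 0 < k) (h : a ≤ k) (d : ℕ) :
    {j : ℤ | thetaExp k a j ≤ d}.Finite := by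
  refine (Set.finite_Icc (-(d + 1 : ℤ)) (d + 1)).subset fun j hj => ?_
  have h1 := abs_le_thetaExp_add_one hk h j
  simp only [Set.mem_ofPred_eq] at hj
  rw [Set.mem_Icc, ← abs_le]
  omega

/-- The finite Jacobi triple product. -/
theorem prod_eq_sum_thetaExp {k a b n : ℕ} (hab : a + b = k) (ε : ℚ⟦X⟧ˣ) :
    ∏ i ∈ range n, ((1 + ε.val * X ^ (k * i + a)) * (1 + ε⁻¹.val * X ^ (k * i + b))) =
      ∑ i ∈ range (2 * n + 1), (ε ^ ((i : ℤ) - n)).val * (X : ℚ⟦X⟧) ^ thetaExp k a (i - n) *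
        qBinomial (X ^ k) (2 * n) i := by
  have h := prod_add_mul_pow_eq_sum_qBinomial ((X : ℚ⟦X⟧) ^ k) (X ^ (k * n)) (ε.val * X ^ a) (2 * n)
  have hE : ε.val ^ n * X ^ (k * n * n + a * n + k * n.choose 2) ≠ 0 :=
    mul_ne_zero (pow_ne_zero _ ε.ne_zero) (pow_ne_zero _ X_ne_zero)
  apply mul_left_cancel₀ hE
  have hl : ∏ i ∈ range (2 * n), ((X : ℚ⟦X⟧) ^ (k * n) + ε.val * X ^ a * (X ^ k) ^ i) =
      ε.val ^ n * X ^ (k * n * n + a * n + k * n.choose 2) *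
        ∏ i ∈ range n, ((1 + ε.val * X ^ (k * i + a)) * (1 + ε⁻¹.val * X ^ (k * i + b))) := by
    have h1 : ∏ i ∈ range n, ((X : ℚ⟦X⟧) ^ (k * n) + ε.val * X ^ a * (X ^ k) ^ i) =
        (∏ i ∈ range n, (ε.val * X ^ a * (X ^ k) ^ i)) *
          ∏ i ∈ range n, (1 + ε⁻¹.val * X ^ (k * i + b)) := by
      rw [← prod_range_reflect (fun i => 1 + ε⁻¹.val * X ^ (k * i + b)),
        ← prod_mul_distrib]
      refine prod_congr rfl fun i hi => ?_
      obtain ⟨t, rfl⟩ := Nat.exists_eq_add_of_lt (mem_range.mp hi)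
      rw [show i + t + 1 - 1 - i = t by omega, mul_add, mul_one, add_comm, ← hab]
      linear_combination (-X ^ a * (X ^ (a + b)) ^ i * X ^ ((a + b) * t + b)) * ε.mul_inv
    have h2 : ∏ i ∈ range n, ((X : ℚ⟦X⟧) ^ (k * n) + ε.val * X ^ a * (X ^ k) ^ (n + i)) =
        X ^ (k * n * n) * ∏ i ∈ range n, (1 + ε.val * X ^ (k * i + a)) := by
      rw [pow_mul _ (k * n), ← card_range n, ← prod_const, card_range, ← prod_mul_distrib]
      exact prod_congr rfl fun i _ => by ring
    have h3 : ∏ i ∈ range n, (ε.val * X ^ a * (X ^ k) ^ i) =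
        ε.val ^ n * X ^ (a * n + k * n.choose 2) := by
      rw [prod_mul_distrib, prod_pow_eq_pow_sum, sum_range_id, ← Nat.choose_two_right, prod_const,
        card_range]
      ring
    rw [two_mul, prod_range_add, h1, h2, h3, prod_mul_distrib]
    ring
  rw [← hl, h, mul_sum]
  refine sum_congr rfl fun i hi => ?_
  have hi : i ≤ 2 * n := by simpa [Nat.lt_succ_iff] using hi
  have he : k * i.choose 2 + a * i + k * n * (2 * n - i) =
      k * n * n + a * n + k * n.choose 2 + thetaExp k a (i - n) := by
    have hc (t : ℕ) : 2 * (t.choose 2 : ℤ) = t * (t - 1) := by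
      rcases t with _ | t
      · simp
      · rw [Nat.choose_two_right]
        have : 2 ∣ (t + 1) * (t + 1 - 1) := (Nat.even_mul_pred_self (t + 1)).two_dvd
        zify [this]
        rw [Int.mul_ediv_cancel' (by exact_mod_cast this)]
        simp
    have := two_mul_thetaExp (show a ≤ k by omega) ((i : ℤ) - n)
    zify [hi]
    have h1 := hc i
    have h2 := hc n
    apply mul_left_cancel₀ (two_ne_zero (α := ℤ))
    linear_combination k * h1 - k * h2 - this
  have hε : ε.val ^ i = ε.val ^ n * (ε ^ ((i : ℤ) - n)).val := by
    rw [← Units.val_pow_eq_pow_val, ← Units.val_pow_eq_pow_val, ← Units.val_mul, ← zpow_natCast,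
      ← zpow_natCast, ← zpow_add]
    congr 2
    ring
  rw [mul_pow, hε]
  linear_combination (ε.val ^ n * (ε ^ ((i : ℤ) - n)).val * qBinomial (X ^ k) (2 * n) i) *
    congrArg ((X : ℚ⟦X⟧) ^ ·) he

theorem summable_mul_X_pow {ι : Type*} (c : ι → ℚ⟦X⟧) (e : ι → ℕ)
    (he : ∀ d, {i | e i ≤ d}.Finite) : Summable fun i => c i * X ^ e i := by
  rw [show (Summable fun i => c i * X ^ e i) ↔ _ from
    PowerSeries.WithPiTopology.summable_iff_summable_coeff ℚ]
  refine fun d => summable_of_hasFiniteSupport ((he d).subset fun i hi => ?_)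
  by_contra hlt
  exact hi (by simp [coeff_mul_X_pow', show ¬ e i ≤ d from hlt])

theorem multipliable_of_X_pow_dvd_sub_one {f : ℕ → ℚ⟦X⟧} {e : ℕ → ℕ} (he : ∀ n, n ≤ e n)
    (h : ∀ n, X ^ e n ∣ f n - 1) : Multipliable f := by
  have ht : Tendsto (fun n => (f n - 1).order) atTop (𝓝 ⊤) := by
    refine ENat.tendsto_nhds_top_iff_natCast_lt.mpr fun n => eventually_atTop.mpr ⟨n + 1, ?_⟩
    intro m hm
    refine lt_of_lt_of_le ?_ (nat_le_order _ _ fun i hi => X_pow_dvd_iff.mp (h m) i hi)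
    exact_mod_cast (show n < e m by have := he m; omega)
  have hm : Multipliable fun n => 1 + (f n - 1) :=
    PowerSeries.WithPiTopology.multipliable_one_add_of_tendsto_order_atTop_nhds_top ℚ ht
  simpa using hm

theorem multipliable_one_add_mul_X_pow (c : ℚ⟦X⟧) {k : ℕ} (hk : 0 < k) (a : ℕ) :
    Multipliable fun n : ℕ => 1 + c * X ^ (k * n + a) :=
  multipliable_of_X_pow_dvd_sub_one (e := fun n => k * n + a)
    (fun n => by nlinarith) (fun n => by simp)

theorem multipliable_one_sub_X_pow {k : ℕ} (hk : 0 < k) (a : ℕ) :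
    Multipliable fun n : ℕ => 1 - (X : ℚ⟦X⟧) ^ (k * n + a) := by
  simpa [sub_eq_add_neg] using multipliable_one_add_mul_X_pow (-1) hk a

theorem tendsto_zero_of_X_pow_dvd {f : ℕ → ℚ⟦X⟧} (h : ∀ n, X ^ n ∣ f n) :
    Tendsto f atTop (𝓝 0) := by
  rw [show Tendsto f atTop (𝓝 0) ↔ _ from
    PowerSeries.WithPiTopology.tendsto_iff_coeff_tendsto ℚ f atTop 0]
  refine fun d => tendsto_atTop_of_eventually_const (i₀ := d + 1) fun n hn => ?_
  rw [map_zero]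
  exact X_pow_dvd_iff.mp (h n) d (by omega)

/-- The theta series `∑_j ε ^ j * q ^ (k j (j - 1) / 2 + a j)`. -/
def theta (ε : ℚ⟦X⟧ˣ) (k a : ℕ) : ℚ⟦X⟧ := ∑' j : ℤ, (ε ^ j).val * X ^ thetaExp k a j

theorem hasSum_theta (ε : ℚ⟦X⟧ˣ) {k a : ℕ} (hk : 0 < k) (ha : a ≤ k) :
    HasSum (fun j : ℤ => (ε ^ j).val * (X : ℚ⟦X⟧) ^ thetaExp k a j) (theta ε k a) :=
  (summable_mul_X_pow _ _ (finite_thetaExp_le hk ha)).hasSum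

theorem X_pow_dvd_qPochhammer_mul_prod_sub_sum {k a b : ℕ} (hk : 0 < k) (hab : a + b = k)
    (ε : ℚ⟦X⟧ˣ) (n : ℕ) :
    X ^ n ∣ qPochhammer (X ^ k) n * ∏ i ∈ range n,
        ((1 + ε.val * X ^ (k * i + a)) * (1 + ε⁻¹.val * X ^ (k * i + b))) -
      ∑ j ∈ Icc (-n : ℤ) n, (ε ^ j).val * X ^ thetaExp k a j := by
  have hr : ∑ j ∈ Icc (-n : ℤ) n, (ε ^ j).val * X ^ thetaExp k a j =
      ∑ i ∈ range (2 * n + 1), (ε ^ ((i : ℤ) - n)).val * X ^ thetaExp k a (i - n) := by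
    symm
    refine sum_bij (fun i _ => (i : ℤ) - n) ?_ ?_ ?_ ?_
    · intro i hi
      simp only [mem_range, mem_Icc] at hi ⊢
      omega
    · intro i _ i' _ h
      omega
    · intro j hj
      simp only [mem_Icc] at hj
      exact ⟨(j + n).toNat, by simp only [mem_range]; omega, by omega⟩
    · intros; rfl
  rw [hr, prod_eq_sum_thetaExp hab, mul_sum, ← sum_sub_distrib]
  refine dvd_sum fun i hi => ?_
  have hi : i ≤ 2 * n := by simpa [Nat.lt_succ_iff] using hi
  have habs : |(i : ℤ) - n| ≤ n := by rw [abs_le]; omega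
  have hu : IsUnit (qPochhammer ((X : ℚ⟦X⟧) ^ k) (n - ((i : ℤ) - n).natAbs)) := by
    rw [isUnit_iff_constantCoeff, qPochhammer, map_prod]
    simp [hk.ne']
  have hd := dvd_qPochhammer_mul_qBinomial_sub_one ((X : ℚ⟦X⟧) ^ k) hi
    (m := n - ((i : ℤ) - n).natAbs) (by omega) (by omega) (by omega) hu
  rw [← pow_mul] at hd
  refine (pow_dvd_pow X (le_thetaExp_add hk (show a ≤ k by omega) _ habs)).trans ?_
  rw [pow_add]
  convert (mul_dvd_mul_left (X ^ thetaExp k a (i - n)) hd).mul_left (ε ^ ((i : ℤ) - n)).val using 1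
  ring

/-- The Jacobi triple product identity. -/
theorem theta_eq_tprod {k a b : ℕ} (hk : 0 < k) (hab : a + b = k) (ε : ℚ⟦X⟧ˣ) :
    theta ε k a = phi k * ((∏' n : ℕ, (1 + ε.val * X ^ (k * n + a))) *
      ∏' n : ℕ, (1 + ε⁻¹.val * X ^ (k * n + b))) := by
  have hIcc : Tendsto (fun n : ℕ => Icc (-n : ℤ) n) atTop atTop :=
    tendsto_atTop_finset_of_monotone (fun m n h => Icc_subset_Icc (by omega) (by omega))
      fun j => ⟨j.natAbs, by simp only [mem_Icc]; omega⟩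
  have h1 : Tendsto (fun n : ℕ => ∑ j ∈ Icc (-n : ℤ) n, (ε ^ j).val * (X : ℚ⟦X⟧) ^ thetaExp k a j)
      atTop (𝓝 (theta ε k a)) :=
    (hasSum_theta ε hk (by omega)).comp hIcc
  have hphi : Tendsto (fun n : ℕ => qPochhammer ((X : ℚ⟦X⟧) ^ k) n) atTop (𝓝 (phi k)) := by
    have := (multipliable_one_sub_X_pow hk k).tendsto_prod_tprod_nat
    simpa only [phi, qPochhammer, ← pow_mul, mul_add, mul_one] using this
  have h2 := hphi.mul ((multipliable_one_add_mul_X_pow ε.val hk a).tendsto_prod_tprod_nat.mul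
    (multipliable_one_add_mul_X_pow ε⁻¹.val hk b).tendsto_prod_tprod_nat)
  simp only [← prod_mul_distrib] at h2
  have h3 := tendsto_zero_of_X_pow_dvd (X_pow_dvd_qPochhammer_mul_prod_sub_sum hk hab ε)
  exact (sub_eq_zero.mp (tendsto_nhds_unique (h2.sub h1) h3)).symm

/-- A product over `ℕ` splits into the products over the residue classes modulo `m`. -/
theorem tprod_eq_prod_tprod_residue {f : ℕ → ℚ⟦X⟧} {m : ℕ} (hm : 0 < m) (hf : Multipliable f)
    (hr : ∀ r < m, Multipliable fun n => f (m * n + r)) :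
    ∏' n, f n = ∏ r ∈ range m, ∏' n, f (m * n + r) := by
  have h1 : Tendsto (fun n => ∏ i ∈ range (m * n), f i) atTop (𝓝 (∏' n, f n)) :=
    hf.tendsto_prod_tprod_nat.comp (tendsto_id.const_mul_atTop' hm)
  have h2 : Tendsto (fun n => ∏ r ∈ range m, ∏ i ∈ range n, f (m * i + r)) atTop
      (𝓝 (∏ r ∈ range m, ∏' n, f (m * n + r))) :=
    tendsto_finsetProd _ fun r hrm => (hr r (mem_range.mp hrm)).tendsto_prod_tprod_nat
  refine tendsto_nhds_unique h1 (h2.congr fun n => ?_)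
  rw [Finset.prod_comm]
  induction n with
  | zero => simp
  | succ n ih => rw [prod_range_succ, ih, mul_add_one, prod_range_add]

/-- The product `∏_{n ≥ 0} (1 - q ^ (k n + a))`. -/
def eulerProd (k a : ℕ) : ℚ⟦X⟧ := ∏' n : ℕ, (1 - (X : ℚ⟦X⟧) ^ (k * n + a))

theorem phi_eq_prod_eulerProd {j m : ℕ} (hj : 0 < j) (hm : 0 < m) :
    phi j = ∏ r ∈ range m, eulerProd (j * m) (j * (r + 1)) := by
  have he (n r : ℕ) : j * (m * n + r + 1) = j * m * n + j * (r + 1) := by ring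
  rw [phi, tprod_eq_prod_tprod_residue hm]
  · simp only [he, eulerProd]
  · simpa only [mul_add, mul_one] using multipliable_one_sub_X_pow hj j
  · intro r _
    simpa only [he] using multipliable_one_sub_X_pow (Nat.mul_pos hj hm) (j * (r + 1))

theorem phi_eq_eulerProd (j : ℕ) : phi j = eulerProd j j := by
  simp only [phi, eulerProd, mul_add, mul_one]

theorem theta_neg_one_eq {k a b : ℕ} (hk : 0 < k) (hab : a + b = k) :
    theta (-1) k a = eulerProd k k * (eulerProd k a * eulerProd k b) := by
  rw [theta_eq_tprod hk hab, phi_eq_eulerProd]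
  simp [eulerProd, sub_eq_add_neg]

theorem constantCoeff_phi {j : ℕ} (hj : 0 < j) : constantCoeff (phi j) = 1 := by
  have h : Tendsto (fun n => ∏ i ∈ range n, (1 - (X : ℚ⟦X⟧) ^ (j * i + j))) atTop (𝓝 (phi j)) := by
    simpa only [phi_eq_eulerProd, eulerProd] using
      (multipliable_one_sub_X_pow hj j).tendsto_prod_tprod_nat
  have hc := ((PowerSeries.WithPiTopology.continuous_constantCoeff ℚ).tendsto (phi j)).comp h
  refine tendsto_nhds_unique hc ?_
  simp [Function.comp_def, map_prod, hj.ne']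

theorem tprod_inv_mul_eulerProd {k a b : ℕ} (hk : 0 < k) (ha : 0 < a) (hb : 0 < b) :
    (∏' n : ℕ, ((1 - (X : ℚ⟦X⟧) ^ (k * n + a)) * (1 - X ^ (k * n + b)))⁻¹) *
      (eulerProd k a * eulerProd k b) = 1 := by
  have hA := multipliable_one_sub_X_pow hk a
  have hB := multipliable_one_sub_X_pow hk b
  have hne (n : ℕ) :
      constantCoeff ((1 - (X : ℚ⟦X⟧) ^ (k * n + a)) * (1 - X ^ (k * n + b))) ≠ 0 := by
    simp [ha.ne', hb.ne']
  have hI : Multipliable fun n : ℕ =>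
      ((1 - (X : ℚ⟦X⟧) ^ (k * n + a)) * (1 - X ^ (k * n + b)))⁻¹ := by
    refine multipliable_of_X_pow_dvd_sub_one (e := fun n => k * n) (fun n => by nlinarith)
      fun n => ?_
    refine ⟨((1 - (X : ℚ⟦X⟧) ^ (k * n + a)) * (1 - X ^ (k * n + b)))⁻¹ *
      (X ^ a + X ^ b - X ^ (k * n + a + b)), ?_⟩
    linear_combination PowerSeries.mul_inv_cancel _ (hne n)
  rw [eulerProd, eulerProd, ← hA.tprod_mul hB, ← hI.tprod_mul (hA.mul hB)]
  exact (tprod_congr fun n => PowerSeries.inv_mul_cancel _ (hne n)).trans tprod_one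

theorem theta_eq_phi_mul_G {j : ℕ} (hj : 0 < j) : theta (-1) (5 * j) (3 * j) = phi j * G j := by
  have hG := tprod_inv_mul_eulerProd (k := 5 * j) (a := 4 * j) (b := j) (by omega) (by omega) hj
  have hGj : G j = ∏' n : ℕ, ((1 - (X : ℚ⟦X⟧) ^ (5 * j * n + 4 * j)) *
      (1 - X ^ (5 * j * n + j)))⁻¹ := by
    exact tprod_congr fun n => by
      rw [show j * (5 * n + 4) = 5 * j * n + 4 * j by ring,
        show j * (5 * n + 1) = 5 * j * n + j by ring]
  have hphi := phi_eq_prod_eulerProd hj (m := 5) (by norm_num)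
  simp only [prod_range_succ, prod_range_zero, one_mul, Nat.mul_comm j, Nat.reduceAdd] at hphi
  rw [← hGj] at hG
  rw [theta_neg_one_eq (b := 2 * j) (by omega) (by omega), hphi]
  linear_combination (-eulerProd (5 * j) (2 * j) * eulerProd (5 * j) (3 * j) *
    eulerProd (5 * j) (5 * j)) * hG

theorem theta_eq_phi_mul_H {j : ℕ} (hj : 0 < j) : theta (-1) (5 * j) (4 * j) = phi j * H j := by
  have hH := tprod_inv_mul_eulerProd (k := 5 * j) (a := 3 * j) (b := 2 * j) (by omega) (by omega)
    (by omega)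
  have hHj : H j = ∏' n : ℕ, ((1 - (X : ℚ⟦X⟧) ^ (5 * j * n + 3 * j)) *
      (1 - X ^ (5 * j * n + 2 * j)))⁻¹ := by
    exact tprod_congr fun n => by
      rw [show j * (5 * n + 3) = 5 * j * n + 3 * j by ring,
        show j * (5 * n + 2) = 5 * j * n + 2 * j by ring]
  have hphi := phi_eq_prod_eulerProd hj (m := 5) (by norm_num)
  simp only [prod_range_succ, prod_range_zero, one_mul, Nat.mul_comm j, Nat.reduceAdd] at hphi
  rw [← hHj] at hH
  rw [theta_neg_one_eq (b := j) (by omega) (by omega), hphi]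
  linear_combination (-eulerProd (5 * j) j * eulerProd (5 * j) (4 * j) *
    eulerProd (5 * j) (5 * j)) * hH

theorem theta_one_mul_phi : theta 1 1 1 * phi 1 = 2 * phi 2 ^ 2 := by
  have hm (a : ℕ) : Multipliable fun n : ℕ => 1 + (X : ℚ⟦X⟧) ^ (n + a) := by
    simpa using multipliable_one_add_mul_X_pow 1 one_pos a
  have h0 : ∏' n : ℕ, (1 + (X : ℚ⟦X⟧) ^ n) = 2 * ∏' n : ℕ, (1 + (X : ℚ⟦X⟧) ^ (n + 1)) := by
    rw [tprod_eq_zero_mul' (f := fun n : ℕ => 1 + (X : ℚ⟦X⟧) ^ n) (hm 1), pow_zero,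
      one_add_one_eq_two]
  have h2 : phi 1 * ∏' n : ℕ, (1 + (X : ℚ⟦X⟧) ^ (n + 1)) = phi 2 := by
    have h1 : Multipliable fun n : ℕ => 1 - (X : ℚ⟦X⟧) ^ (1 * (n + 1)) := by
      simpa using multipliable_one_sub_X_pow one_pos 1
    rw [phi, phi, ← h1.tprod_mul (hm 1)]
    exact tprod_congr fun n => by ring
  have h := theta_eq_tprod (k := 1) (a := 1) (b := 0) one_pos rfl 1
  simp only [inv_one, Units.val_one, one_mul, add_zero, h0] at h
  rw [h, ← h2]
  ring

theorem theta_neg_one_mul_phi : theta (-1) 4 2 * phi 4 = phi 2 ^ 2 := by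
  have h := phi_eq_prod_eulerProd (j := 2) (m := 2) two_pos two_pos
  simp only [prod_range_succ, prod_range_zero, one_mul, Nat.reduceAdd, Nat.reduceMul] at h
  rw [theta_neg_one_eq (b := 2) (by norm_num) rfl, phi_eq_eulerProd 4, h]
  ring

theorem two_ne_zero_powerSeries : (2 : ℚ⟦X⟧) ≠ 0 := fun h => by
  have := congrArg constantCoeff h
  rw [map_ofNat, map_zero] at this
  norm_num at this

theorem hasSum_theta_mul_theta (ε δ : ℚ⟦X⟧ˣ) {k a l b : ℕ} (hk : 0 < k) (ha : a ≤ k) (hl : 0 < l)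
    (hb : b ≤ l) :
    HasSum (fun p : ℤ × ℤ => (ε ^ p.1 * δ ^ p.2).val * X ^ (thetaExp k a p.1 + thetaExp l b p.2))
      (theta ε k a * theta δ l b) := by
  have hterm (p : ℤ × ℤ) : (ε ^ p.1).val * (X : ℚ⟦X⟧) ^ thetaExp k a p.1 *
      ((δ ^ p.2).val * X ^ thetaExp l b p.2) =
      (ε ^ p.1 * δ ^ p.2).val * X ^ (thetaExp k a p.1 + thetaExp l b p.2) := by
    rw [Units.val_mul, pow_add]; ring
  have h3 : Summable fun p : ℤ × ℤ =>
      (ε ^ p.1 * δ ^ p.2).val * X ^ (thetaExp k a p.1 + thetaExp l b p.2) := by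
    refine summable_mul_X_pow _ _ fun d => ?_
    refine ((finite_thetaExp_le hk ha d).prod (finite_thetaExp_le hl hb d)).subset fun p hp => ?_
    simp only [Set.mem_ofPred_eq, Set.mem_prod] at hp ⊢
    omega
  refine ((hasSum_theta ε hk ha).mul (hasSum_theta δ hl hb) ?_).congr_fun fun p => (hterm p).symm
  exact h3.congr fun p => (hterm p).symm

/-- The bijection `(r, (n, m)) ↦ (4 m + n + r, m - n)`, which splits `ℤ × ℤ` according to the
residue modulo `5` of the sum of the coordinates. -/
def residueEquiv : Fin 5 × (ℤ × ℤ) ≃ ℤ × ℤ where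
  toFun p := (4 * p.2.2 + p.2.1 + (p.1 : ℕ), p.2.2 - p.2.1)
  invFun p := (⟨((p.1 + p.2) % 5).toNat, by omega⟩,
    ((p.1 + p.2) / 5 - p.2, (p.1 + p.2) / 5))
  left_inv := by
    rintro ⟨⟨r, hr⟩, n, m⟩
    simp only [Prod.mk.injEq, Fin.mk.injEq]
    omega
  right_inv := by
    rintro ⟨a, b⟩
    simp only [Prod.mk.injEq]
    omega

theorem neg_one_zpow_eq {a b : ℤ} (c : ℤ) (h : a = b + 2 * c) :
    (-1 : ℚ⟦X⟧ˣ) ^ a = (-1) ^ b := by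
  rw [h, zpow_add, zpow_mul]
  simp

theorem theta_neg_one_self {k : ℕ} (hk : 0 < k) : theta (-1) k k = 0 := by
  have h := hasSum_theta (-1) hk le_rfl
  have h' := (Equiv.subLeft (-1 : ℤ)).hasSum_iff.mpr h
  have hneg : HasSum (fun j : ℤ => ((-1 : ℚ⟦X⟧ˣ) ^ j).val * (X : ℚ⟦X⟧) ^ thetaExp k k j)
      (-theta (-1) k k) := by
    refine h'.neg.congr_fun fun j => ?_
    have he : thetaExp k k (-1 - j) = thetaExp k k j := by
      have h1 := two_mul_thetaExp (le_refl k) j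
      have h2 := two_mul_thetaExp (le_refl k) (-1 - j)
      zify
      linarith
    have hs : (-1 : ℚ⟦X⟧ˣ) ^ (-1 - j) = -(-1) ^ j := by
      rw [neg_one_zpow_eq (b := j + 1) (-1 - j) (by ring), zpow_add_one]
      simp
    simp [he, hs]
  have := hneg.unique h
  refine (mul_eq_zero.mp ?_).resolve_left two_ne_zero_powerSeries
  linear_combination -this

/-- The quadratic form identity relating the exponents on both sides of
`theta_one_mul_theta_neg_one`. -/
theorem two_mul_thetaExp_residue (n m r : ℤ) :
    2 * ((thetaExp 1 1 (4 * m + n + r) + thetaExp 4 2 (m - n) : ℕ) : ℤ) =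
      5 * n ^ 2 + (2 * r + 1) * n + 4 * (5 * m ^ 2 + (2 * r + 1) * m) + r ^ 2 + r := by
  have h1 := two_mul_thetaExp (k := 1) (a := 1) le_rfl (4 * m + n + r)
  have h2 := two_mul_thetaExp (k := 4) (a := 2) (by norm_num) (m - n)
  push_cast at *
  linear_combination h1 + h2

theorem two_mul_thetaExp_add {a : ℕ} (ha : a ≤ 5) (n m : ℤ) :
    2 * ((thetaExp 5 a n + thetaExp 20 (4 * a) m : ℕ) : ℤ) =
      5 * n ^ 2 + (2 * a - 5) * n + 4 * (5 * m ^ 2 + (2 * a - 5) * m) := by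
  have h1 := two_mul_thetaExp ha n
  have h2 := two_mul_thetaExp (k := 20) (a := 4 * a) (by omega) m
  push_cast at *
  linear_combination h1 + h2

/-- The terms of `theta 1 1 1 * theta (-1) 4 2` in the residue class `r` of `residueEquiv`. -/
def residueTerm (r : ℕ) (p : ℤ × ℤ) : ℚ⟦X⟧ :=
  ((-1 : ℚ⟦X⟧ˣ) ^ (p.2 - p.1)).val *
    X ^ (thetaExp 1 1 (4 * p.2 + p.1 + r) + thetaExp 4 2 (p.2 - p.1))

theorem hasSum_theta_mul_theta_five {a : ℕ} (ha : a ≤ 5) :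
    HasSum (fun p : ℤ × ℤ => ((-1 : ℚ⟦X⟧ˣ) ^ (p.1 + p.2)).val *
      (X : ℚ⟦X⟧) ^ (thetaExp 5 a p.1 + thetaExp 20 (4 * a) p.2))
      (theta (-1) 5 a * theta (-1) 20 (4 * a)) :=
  (hasSum_theta_mul_theta (-1) (-1) (by norm_num) ha (by norm_num) (by omega)).congr_fun
    fun p => by rw [zpow_add]

theorem hasSum_residueTerm {r a c : ℕ} (ha : a ≤ 5) (hra : r + 3 = a) (hc : 2 * c = r ^ 2 + r) :
    HasSum (residueTerm r) (X ^ c * (theta (-1) 5 a * theta (-1) 20 (4 * a))) := by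
  refine ((hasSum_theta_mul_theta_five ha).mul_left (X ^ c)).congr_fun fun ⟨n, m⟩ => ?_
  have he : thetaExp 1 1 (4 * m + n + r) + thetaExp 4 2 (m - n) =
      c + (thetaExp 5 a n + thetaExp 20 (4 * a) m) := by
    have h1 := two_mul_thetaExp_residue n m r
    have h2 := two_mul_thetaExp_add ha n m
    zify at *
    rw [← hra] at h2
    linarith
  simp only [residueTerm, he]
  rw [neg_one_zpow_eq (a := m - n) (b := n + m) (-n) (by ring), pow_add X c]
  ring

theorem hasSum_residueTerm_reflected {r a c : ℕ} (ha : a ≤ 5) (hra : r + a = 7)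
    (hc : 2 * c + 10 * r = r ^ 2 + r + 20) :
    HasSum (residueTerm r) (X ^ c * (theta (-1) 5 a * theta (-1) 20 (4 * a))) := by
  have hR := ((Equiv.subLeft (-1 : ℤ)).prodCongr (Equiv.subLeft (-1 : ℤ))).hasSum_iff.mpr
    (hasSum_theta_mul_theta_five ha)
  refine (hR.mul_left (X ^ c)).congr_fun fun ⟨n, m⟩ => ?_
  have he : thetaExp 1 1 (4 * m + n + r) + thetaExp 4 2 (m - n) =
      c + (thetaExp 5 a (-1 - n) + thetaExp 20 (4 * a) (-1 - m)) := by
    have h1 := two_mul_thetaExp_residue n m r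
    have h2 := two_mul_thetaExp_add ha (-1 - n) (-1 - m)
    zify at *
    rw [show (a : ℤ) = 7 - r by omega] at h2
    linarith
  simp only [residueTerm, he, Function.comp_apply, Equiv.prodCongr_apply, Prod.map_apply,
    Equiv.subLeft_apply]
  rw [neg_one_zpow_eq (a := m - n) (b := -1 - n + (-1 - m)) (m + 1) (by ring), pow_add X c]
  ring

theorem theta_one_mul_theta_neg_one :
    theta 1 1 1 * theta (-1) 4 2 =
      2 * (theta (-1) 5 3 * theta (-1) 20 12 + X * (theta (-1) 5 4 * theta (-1) 20 16)) := by
  have hL := hasSum_theta_mul_theta 1 (-1) (k := 1) (a := 1) (l := 4) (b := 2)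
    (by norm_num) (by norm_num) (by norm_num) (by norm_num)
  have hg : HasSum (fun p : Fin 5 × (ℤ × ℤ) => residueTerm p.1 p.2)
      (theta 1 1 1 * theta (-1) 4 2) :=
    (residueEquiv.hasSum_iff.mpr hL).congr_fun fun p => by simp [residueTerm, residueEquiv]
  have h0 : HasSum (residueTerm 0) (theta (-1) 5 3 * theta (-1) 20 12) := by
    simpa using hasSum_residueTerm (r := 0) (a := 3) (c := 0) (by norm_num) rfl rfl
  have h1 : HasSum (residueTerm 1) (X * (theta (-1) 5 4 * theta (-1) 20 16)) := by
    simpa using hasSum_residueTerm (r := 1) (a := 4) (c := 1) (by norm_num) rfl rfl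
  have h2 : HasSum (residueTerm 2) 0 := by
    simpa [theta_neg_one_self] using
      hasSum_residueTerm (r := 2) (a := 5) (c := 3) (by norm_num) rfl rfl
  have h3 : HasSum (residueTerm 3) (X * (theta (-1) 5 4 * theta (-1) 20 16)) := by
    simpa using hasSum_residueTerm_reflected (r := 3) (a := 4) (c := 1) (by norm_num) rfl rfl
  have h4 : HasSum (residueTerm 4) (theta (-1) 5 3 * theta (-1) 20 12) := by
    simpa using hasSum_residueTerm_reflected (r := 4) (a := 3) (c := 0) (by norm_num) rfl rfl
  have hsum := hg.prod_fiberwise (g := fun r : Fin 5 => ∑' p, residueTerm r p) fun r => by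
    fin_cases r
    exacts [h0.summable.hasSum, h1.summable.hasSum, h2.summable.hasSum, h3.summable.hasSum,
      h4.summable.hasSum]
  have h := hsum.unique (hasSum_fintype _)
  rw [h, Fin.sum_univ_five, show ∑' p, residueTerm (0 : Fin 5) p = _ from h0.tsum_eq,
    show ∑' p, residueTerm (1 : Fin 5) p = _ from h1.tsum_eq,
    show ∑' p, residueTerm (2 : Fin 5) p = _ from h2.tsum_eq,
    show ∑' p, residueTerm (3 : Fin 5) p = _ from h3.tsum_eq,
    show ∑' p, residueTerm (4 : Fin 5) p = _ from h4.tsum_eq]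
  ring

end

/-- One of Ramanujan's forty identities (Watson, 1933):
`G(q)G(q⁴) + q H(q)H(q⁴) = φ(q²)⁴/(φ(q⁴)² φ(q)²)`. -/
theorem ramanujan_watson_GG_qHH :
    G 1 * G 4 + X * (H 1 * H 4) = phi 2 ^ 4 * (phi 4 ^ 2 * phi 1 ^ 2)⁻¹ := by
  have hne : constantCoeff (phi 4 ^ 2 * phi 1 ^ 2) ≠ 0 := by
    simp [constantCoeff_phi]
  have hphi1 : phi 1 ≠ 0 := fun h => by simpa [h] using constantCoeff_phi one_pos
  have hphi4 : phi 4 ≠ 0 := fun h => by simpa [h] using constantCoeff_phi (j := 4) (by norm_num)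
  rw [PowerSeries.eq_mul_inv_iff_mul_eq hne]
  have h := theta_one_mul_theta_neg_one
  have hG1 := theta_eq_phi_mul_G one_pos
  have hG4 := theta_eq_phi_mul_G (j := 4) (by norm_num)
  have hH1 := theta_eq_phi_mul_H one_pos
  have hH4 := theta_eq_phi_mul_H (j := 4) (by norm_num)
  norm_num only at hG1 hG4 hH1 hH4
  rw [hG1, hG4, hH1, hH4] at h
  apply mul_left_cancel₀ (two_ne_zero_powerSeries)
  linear_combination (-phi 1 * phi 4) * h + (theta (-1) 4 2 * phi 4) * theta_one_mul_phi +
    2 * phi 2 ^ 2 * theta_neg_one_mul_phi
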